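/- Let P_m denote the m-th Legendre polynomial (normalized by P_m(1) = 1). For every m ∈ ℕ, every r ≥ 0 and every w ∈ ℂ with |w| = exp(r), one has |P_m((w + 1/w)/2)| ≤ exp(m·r); equivalently, sup_{z ∈ ∂E_r} |P_m(z)| ≤ exp(m·r), where E_r is the closed ellipse {x+iy ∈ ℂ : x²/cosh²(r) + y²/sinh²(r) ≤ 1} with foci ±1. -/

import Mathlib

/-- The `n`-th Legendre polynomial, via the Rodrigues formula
`P_n = (1/(2^n n!)) dⁿ/dxⁿ (x² - 1)ⁿ` (so that `P_n(1) = 1`). -/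
noncomputable def legendreP (n : ℕ) : Polynomial ℝ :=
  Polynomial.C (1 / ((2 : ℝ) ^ n * n.factorial)) *
    (⇑Polynomial.derivative)^[n] ((Polynomial.X ^ 2 - 1) ^ n)

/-- The boundary `∂E_r` of the closed ellipse with foci `±1` and semi-axes
`cosh r`, `sinh r`. -/
def ellipseBoundary (r : ℝ) : Set ℂ :=
  {z : ℂ | z.re ^ 2 / Real.cosh r ^ 2 + z.im ^ 2 / Real.sinh r ^ 2 = 1}

open Finset in
/-- Leibniz expansion of the Rodrigues formula for `P_n`. -/
theorem two_pow_mul_aeval_legendreP (n : ℕ) (z : ℂ) :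
    2 ^ n * Polynomial.aeval z (legendreP n) =
      ∑ k ∈ range (n + 1), (n.choose k : ℂ) ^ 2 * ((z - 1) ^ k * (z + 1) ^ (n - k)) := by
  have hfac : (Polynomial.X ^ 2 - 1 : Polynomial ℝ) ^ n =
      (Polynomial.X - Polynomial.C 1) ^ n * (Polynomial.X + Polynomial.C 1) ^ n := by
    rw [← mul_pow, Polynomial.C_1]
    ring
  have hn : (n.factorial : ℂ) ≠ 0 := by exact_mod_cast n.factorial_ne_zero
  rw [legendreP, hfac, Polynomial.iterate_derivative_mul, map_mul, Polynomial.aeval_C, map_sum]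
  simp only [Polynomial.iterate_derivative_X_sub_pow, Polynomial.iterate_derivative_X_add_pow]
  simp only [map_nsmul, map_mul, map_pow, map_sub, map_add, Polynomial.aeval_X, map_one]
  rw [mul_sum, mul_sum]
  refine sum_congr rfl fun k hk => ?_
  have hkn : k ≤ n := Nat.lt_succ_iff.mp (mem_range.mp hk)
  have hcoef : (n.descFactorial (n - k) : ℂ) * n.descFactorial k = n.factorial * n.choose k := by
    rw [Nat.descFactorial_eq_factorial_mul_choose, Nat.descFactorial_eq_factorial_mul_choose,
      Nat.choose_symm hkn, ← Nat.choose_mul_factorial_mul_factorial hkn]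
    push_cast
    ring
  rw [Nat.sub_sub_self hkn]
  simp only [nsmul_eq_mul, Complex.coe_algebraMap]
  push_cast
  field_simp
  linear_combination (z - 1) ^ k * (z + 1) ^ (n - k) * (n.choose k : ℂ) * hcoef

open Finset in
theorem IsPrimitiveRoot.sum_pow_mul_inv_pow {ζ : ℂ} {N : ℕ} (hζ : IsPrimitiveRoot ζ N) {k l : ℕ}
    (hk : k < N) (hl : l < N) :
    ∑ j ∈ range N, (ζ ^ j) ^ k * ((ζ ^ j)⁻¹) ^ l = if k = l then (N : ℂ) else 0 := by
  have hζ0 : ζ ≠ 0 := hζ.ne_zero (by omega)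
  have hterm : ∀ j, (ζ ^ j) ^ k * ((ζ ^ j)⁻¹) ^ l = (ζ ^ k / ζ ^ l) ^ j := fun j => by
    rw [inv_pow, div_pow, div_eq_mul_inv, ← pow_mul, ← pow_mul, ← pow_mul, ← pow_mul,
      mul_comm j k, mul_comm j l]
  simp only [hterm]
  split_ifs with h
  · simp [h, hζ0]
  · have hne : ζ ^ k / ζ ^ l ≠ 1 := fun h1 =>
      h (hζ.pow_inj hk hl ((div_eq_one_iff_eq (pow_ne_zero _ hζ0)).mp h1))
    rw [geom_sum_eq hne, div_pow, ← pow_mul, ← pow_mul, mul_comm k, mul_comm l, pow_mul, pow_mul,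
      hζ.pow_eq_one]
    simp

open Finset in
/-- Discrete form of Laplace's integral: averaging `((a η + b) (a η⁻¹ + b)) ^ n` over the roots of
unity `η` of order `n + 1` extracts the constant term. -/
theorem IsPrimitiveRoot.sum_mul_pow_eq {ζ : ℂ} {n : ℕ} (hζ : IsPrimitiveRoot ζ (n + 1))
    (a b : ℂ) :
    ∑ j ∈ range (n + 1), ((a * ζ ^ j + b) * (a * (ζ ^ j)⁻¹ + b)) ^ n =
      (n + 1) * ∑ k ∈ range (n + 1), (n.choose k : ℂ) ^ 2 * ((a ^ 2) ^ k * (b ^ 2) ^ (n - k)) := by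
  have hexp : ∀ j, ((a * ζ ^ j + b) * (a * (ζ ^ j)⁻¹ + b)) ^ n =
      ∑ k ∈ range (n + 1), ∑ l ∈ range (n + 1),
        (a ^ k * b ^ (n - k) * n.choose k * (a ^ l * b ^ (n - l) * n.choose l)) *
          ((ζ ^ j) ^ k * ((ζ ^ j)⁻¹) ^ l) := fun j => by
    rw [mul_pow, add_pow, add_pow, sum_mul_sum]
    refine sum_congr rfl fun k _ => sum_congr rfl fun l _ => ?_
    rw [mul_pow, mul_pow]
    ring
  simp only [hexp]
  rw [sum_comm, mul_sum]
  refine sum_congr rfl fun k hk => ?_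
  rw [sum_comm]
  simp only [← mul_sum]
  rw [sum_congr rfl fun l hl => by
    rw [hζ.sum_pow_mul_inv_pow (mem_range.mp hk) (mem_range.mp hl)]]
  simp only [mul_ite, mul_zero, sum_ite_eq, hk, if_true]
  push_cast
  ring

theorem norm_sub_one_mul_add_one_le {w η : ℂ} (hw : 1 ≤ ‖w‖) (hη : ‖η‖ = 1) :
    ‖((w - 1) * η + (w + 1)) * ((w - 1) * η⁻¹ + (w + 1))‖ ≤ 4 * ‖w‖ ^ 2 := by
  have hη0 : η ≠ 0 := norm_ne_zero_iff.mp (by rw [hη]; exact one_ne_zero)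
  have hsum : η + η⁻¹ = 2 * (η.re : ℂ) := by
    rw [Complex.inv_eq_conj hη, Complex.add_conj]
    push_cast
    ring
  have hre := abs_le.mp ((Complex.abs_re_le_norm η).trans_eq hη)
  have hfactor : ((w - 1) * η + (w + 1)) * ((w - 1) * η⁻¹ + (w + 1)) =
      ((2 * (1 + η.re) : ℝ) : ℂ) * w ^ 2 + ((2 * (1 - η.re) : ℝ) : ℂ) := by
    push_cast
    linear_combination (w ^ 2 - 1) * hsum + (w - 1) ^ 2 * mul_inv_cancel₀ hη0
  rw [hfactor]
  refine (norm_add_le _ _).trans ?_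
  rw [norm_mul, norm_pow, Complex.norm_real, Complex.norm_real,
    Real.norm_of_nonneg (by linarith), Real.norm_of_nonneg (by linarith)]
  have hw2 : 1 ≤ ‖w‖ ^ 2 := one_le_pow₀ hw
  nlinarith

open Finset in
theorem norm_aeval_legendreP_joukowski_le (n : ℕ) {w : ℂ} (hw : 1 ≤ ‖w‖) :
    ‖Polynomial.aeval ((w + w⁻¹) / 2) (legendreP n)‖ ≤ ‖w‖ ^ n := by
  have hw0 : w ≠ 0 := norm_ne_zero_iff.mp (by linarith)
  have hζ := Complex.isPrimitiveRoot_exp (n + 1) n.succ_ne_zero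
  set ζ := Complex.exp (2 * Real.pi * Complex.I / (n + 1 : ℕ))
  have hnorm : ‖ζ‖ = 1 := hζ.norm'_eq_one n.succ_ne_zero
  have hmean : (n + 1) * ((4 * w) ^ n * (2 ^ n * Polynomial.aeval ((w + w⁻¹) / 2) (legendreP n))) =
      2 ^ n * ∑ j ∈ range (n + 1),
        (((w - 1) * ζ ^ j + (w + 1)) * ((w - 1) * (ζ ^ j)⁻¹ + (w + 1))) ^ n := by
    rw [hζ.sum_mul_pow_eq, two_pow_mul_aeval_legendreP, mul_left_comm (2 ^ n : ℂ)]
    congr 1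
    rw [mul_sum, mul_sum]
    refine sum_congr rfl fun k hk => ?_
    have hkn : n = k + (n - k) := (Nat.add_sub_cancel' (Nat.lt_succ_iff.mp (mem_range.mp hk))).symm
    have h1 : 4 * w * ((w + w⁻¹) / 2 - 1) = 2 * (w - 1) ^ 2 := by field_simp; ring
    have h2 : 4 * w * ((w + w⁻¹) / 2 + 1) = 2 * (w + 1) ^ 2 := by field_simp; ring
    have hsplit : ∀ c : ℂ, c ^ n = c ^ k * c ^ (n - k) := fun c => by rw [← pow_add, ← hkn]
    have h1k := congrArg (· ^ k) h1
    have h2k := congrArg (· ^ (n - k)) h2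
    simp only [mul_pow _ _ k, mul_pow _ _ (n - k)] at h1k h2k
    rw [hsplit, hsplit, mul_pow, mul_pow]
    linear_combination (n.choose k : ℂ) ^ 2 * (4 ^ (n - k) * w ^ (n - k) *
      ((w + w⁻¹) / 2 + 1) ^ (n - k) * h1k + 2 ^ k * ((w - 1) ^ 2) ^ k * h2k)
  have hbound : ‖∑ j ∈ range (n + 1),
      (((w - 1) * ζ ^ j + (w + 1)) * ((w - 1) * (ζ ^ j)⁻¹ + (w + 1))) ^ n‖ ≤
      (n + 1) * (4 * ‖w‖ ^ 2) ^ n := by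
    have hconst : (n + 1) * (4 * ‖w‖ ^ 2) ^ n = ∑ _j ∈ range (n + 1), (4 * ‖w‖ ^ 2) ^ n := by simp
    rw [hconst]
    refine norm_sum_le_of_le _ fun j _ => ?_
    rw [norm_pow]
    gcongr
    exact norm_sub_one_mul_add_one_le hw (by rw [norm_pow, hnorm, one_pow])
  have hmean' := congrArg norm hmean
  have hcast : ‖(n + 1 : ℂ)‖ = n + 1 := by exact_mod_cast Complex.norm_natCast (n + 1)
  simp only [norm_mul, norm_pow, hcast, Complex.norm_ofNat] at hmean'
  have hpos : 0 < (n + 1 : ℝ) * ((4 * ‖w‖) ^ n * 2 ^ n) := by positivity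
  refine le_of_mul_le_mul_left ?_ hpos
  calc (n + 1 : ℝ) * ((4 * ‖w‖) ^ n * 2 ^ n) * ‖Polynomial.aeval ((w + w⁻¹) / 2) (legendreP n)‖
      = 2 ^ n * ‖∑ j ∈ range (n + 1),
          (((w - 1) * ζ ^ j + (w + 1)) * ((w - 1) * (ζ ^ j)⁻¹ + (w + 1))) ^ n‖ := by
        rw [← hmean']; ring
    _ ≤ 2 ^ n * ((n + 1) * (4 * ‖w‖ ^ 2) ^ n) := by gcongr
    _ = (n + 1 : ℝ) * ((4 * ‖w‖) ^ n * 2 ^ n) * ‖w‖ ^ n := by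
        rw [mul_pow, mul_pow, ← pow_mul, two_mul, pow_add]; ring

/-- Every point of `∂E_r` is the image of a point of the circle of radius `exp r` under the
Joukowski map. -/
theorem exists_joukowski_eq_of_mem_ellipseBoundary {r : ℝ} (hr : r ≠ 0) {z : ℂ}
    (hz : z ∈ ellipseBoundary r) : ∃ w : ℂ, ‖w‖ = Real.exp r ∧ (w + w⁻¹) / 2 = z := by
  have hs : Real.sinh r ≠ 0 := Real.sinh_ne_zero.mpr hr
  have hc : Real.cosh r ≠ 0 := (Real.cosh_pos r).ne'
  set u : ℂ := ⟨z.re / Real.cosh r, z.im / Real.sinh r⟩ with hu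
  have hu1 : ‖u‖ = 1 := by
    rw [← sq_eq_sq₀ (norm_nonneg u) zero_le_one, Complex.sq_norm, Complex.normSq_apply, one_pow]
    simpa [hu, ellipseBoundary, ← sq, div_pow] using! hz
  refine ⟨(Real.exp r : ℂ) * u, ?_, ?_⟩
  · rw [norm_mul, hu1, mul_one, Complex.norm_real, Real.norm_of_nonneg (Real.exp_pos r).le]
  · rw [mul_inv, ← Complex.ofReal_inv, ← Real.exp_neg, Complex.inv_eq_conj hu1]
    have hre : z.re = Real.cosh r * u.re := by simp only [hu]; field_simp
    have him : z.im = Real.sinh r * u.im := by simp only [hu]; field_simp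
    rw [Real.cosh_eq] at hre
    rw [Real.sinh_eq] at him
    apply Complex.ext
    · rw [Complex.div_ofNat_re, Complex.add_re, Complex.re_ofReal_mul, Complex.re_ofReal_mul,
        Complex.conj_re, hre]
      ring
    · rw [Complex.div_ofNat_im, Complex.add_im, Complex.im_ofReal_mul, Complex.im_ofReal_mul,
        Complex.conj_im, him]
      ring

/-- Growth bound for Legendre polynomials on ellipses with foci `±1`:
`|P_m((w + 1/w)/2)| ≤ exp (m r)` whenever `|w| = exp r` with `r ≥ 0`; equivalently,
`sup_{z ∈ ∂E_r} |P_m(z)| ≤ exp (m r)`. -/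
theorem legendre_growth_on_ellipse (m : ℕ) :
    (∀ r : ℝ, 0 ≤ r → ∀ w : ℂ, ‖w‖ = Real.exp r →
      ‖Polynomial.aeval ((w + w⁻¹) / 2) (legendreP m)‖ ≤ Real.exp (m * r)) ∧
    (∀ r : ℝ, 0 < r → ∀ z ∈ ellipseBoundary r,
      ‖Polynomial.aeval z (legendreP m)‖ ≤ Real.exp (m * r)) := by
  have hcircle : ∀ r : ℝ, 0 ≤ r → ∀ w : ℂ, ‖w‖ = Real.exp r →
      ‖Polynomial.aeval ((w + w⁻¹) / 2) (legendreP m)‖ ≤ Real.exp (m * r) := fun r hr w hw => by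
    rw [Real.exp_nat_mul, ← hw]
    exact norm_aeval_legendreP_joukowski_le m (hw ▸ Real.one_le_exp hr)
  refine ⟨hcircle, fun r hr z hz => ?_⟩
  obtain ⟨w, hw, rfl⟩ := exists_joukowski_eq_of_mem_ellipseBoundary hr.ne' hz
  exact hcircle r hr.le w hw
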